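/- arXiv:1412.7321 — 3 statements merged into one kernel-verified Lean document; each statement's English description precedes it below -/
import Mathlib

section
/- For every integer j with 1 ≤ j ≤ k, the mixed partial derivative ∂/∂h ∂^{j-1}/∂t^{j-1} [ Σ_{i=1}^{k} f(c_i(t,0,h)) ] evaluated at t = h = 0 equals ∂^{j}/∂t^{j} [ f(c(t,0)) ] evaluated at t = 0. -/
open Filter Topology in
lemma aux_comm {E : Type*} [NormedAddCommGroup E] [NormedSpace ℝ E] (U : Set (ℝ × ℝ)) (hU : IsOpen U)
    (n : ℕ) : ∀ (G : ℝ × ℝ → E) (_ : ∀ p ∈ U, ContDiffAt ℝ (⊤ : ℕ∞) G p) (t₀ h₀ : ℝ) (_ : (t₀, h₀) ∈ U),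
    deriv (fun h => iteratedDeriv n (fun t => G (t, h)) t₀) h₀
      = iteratedDeriv n (fun t => deriv (fun h => G (t, h)) h₀) t₀ := by
  have hd1 : ∀ (F : Type _) [NormedAddCommGroup F] [NormedSpace ℝ F] (G : ℝ × ℝ → F) (t h : ℝ),
      DifferentiableAt ℝ G (t, h) →
      HasDerivAt (fun t => G (t, h)) (fderiv ℝ G (t, h) (1, 0)) t := by
    intro F _ _ G t h hG
    exact hG.hasFDerivAt.comp_hasDerivAt t ((hasDerivAt_id t).prodMk (hasDerivAt_const t h))
  have hd2 : ∀ (F : Type _) [NormedAddCommGroup F] [NormedSpace ℝ F] (G : ℝ × ℝ → F) (t h : ℝ),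
      DifferentiableAt ℝ G (t, h) →
      HasDerivAt (fun h => G (t, h)) (fderiv ℝ G (t, h) (0, 1)) h := by
    intro F _ _ G t h hG
    exact hG.hasFDerivAt.comp_hasDerivAt h ((hasDerivAt_const h t).prodMk (hasDerivAt_id h))
  induction n with
  | zero => intro G hG t₀ h₀ hp; simp
  | succ n ih =>
    intro G hG t₀ h₀ hp
    have hev1 : ∀ h t, (t, h) ∈ U → ∀ᶠ s in 𝓝 t, (s, h) ∈ U := fun h t hth =>
      (show Continuous (fun s : ℝ => (s, h)) by fun_prop).continuousAt.eventually (hU.mem_nhds hth)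
    have hev2 : ∀ h t, (t, h) ∈ U → ∀ᶠ s in 𝓝 h, (t, s) ∈ U := fun h t hth =>
      (show Continuous (fun s : ℝ => (t, s)) by fun_prop).continuousAt.eventually (hU.mem_nhds hth)
    have hD : ∀ p ∈ U, DifferentiableAt ℝ G p := fun p hp => (hG p hp).differentiableAt (by simp)
    have hG' : ∀ p ∈ U, ContDiffAt ℝ (⊤ : ℕ∞) (fderiv ℝ G) p := fun p hp =>
      (hG p hp).fderiv_right (by simp)
    have hD' : ∀ p ∈ U, DifferentiableAt ℝ (fderiv ℝ G) p := fun p hp =>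
      (hG' p hp).differentiableAt (by simp)
    have e1 : (fun h => iteratedDeriv (n+1) (fun t => G (t, h)) t₀) =ᶠ[𝓝 h₀]
        (fun h => iteratedDeriv n (fun t => fderiv ℝ G (t, h) (1, 0)) t₀) := by
      filter_upwards [hev2 h₀ t₀ hp] with h hh
      rw [iteratedDeriv_succ']
      apply Filter.EventuallyEq.iteratedDeriv_eq
      filter_upwards [hev1 h t₀ hh] with t ht
      exact (hd1 _ G t h (hD _ ht)).deriv
    rw [e1.deriv_eq, ih (fun p => fderiv ℝ G p (1, 0))
      (fun p hp => (hG' p hp).clm_apply contDiffAt_const) t₀ h₀ hp, iteratedDeriv_succ']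
    apply Filter.EventuallyEq.iteratedDeriv_eq
    filter_upwards [hev1 h₀ t₀ hp] with t ht
    have e2 : (fun t => deriv (fun h => G (t, h)) h₀) =ᶠ[𝓝 t]
        (fun t => fderiv ℝ G (t, h₀) (0, 1)) := by
      filter_upwards [hev1 h₀ t ht] with t ht
      exact (hd2 _ G t h₀ (hD _ ht)).deriv
    rw [e2.deriv_eq]
    have a1 := ((hd2 _ (fderiv ℝ G) t h₀ (hD' _ ht)).clm_apply
      (hasDerivAt_const h₀ ((1 : ℝ), (0 : ℝ)))).deriv
    have a2 := ((hd1 _ (fderiv ℝ G) t h₀ (hD' _ ht)).clm_apply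
      (hasDerivAt_const t ((0 : ℝ), (1 : ℝ)))).deriv
    rw [a1, a2]
    have hs : IsSymmSndFDerivAt ℝ G (t, h₀) := (hG _ ht).isSymmSndFDerivAt (by
      simp only [minSmoothness_of_isRCLikeNormedField]
      exact WithTop.coe_le_coe.2 (le_top : (2 : ℕ∞) ≤ ⊤))
    simpa using hs.eq (0, 1) (1, 0)

/-- **Lemma (second identity for the auxiliary curves `c_i`).**
With `c (t,s) = x + s•y + ∑_{m=1}^k t^m • ξ_m`,
`c_1 (t,s,h) = x + h•ξ_1 + s•y + ∑_{m=1}^k t^m • ξ_m` and, for `2 ≤ i ≤ k`,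
`c_i (t,s,h) = x + s•y + ∑_{m=1}^k t^m • ξ_m + (i·h·t^{i-1}) • ξ_i`,
for every `1 ≤ j ≤ k`:
`∂/∂h ∂^{j-1}/∂t^{j-1} [∑_{i=1}^k f (c_i (t,0,h))] |₀ = ∂^j/∂t^j [f (c (t,0))] |₀`. -/
theorem mixed_partial_sum_curves_eq_h
    {E : Type*} [NormedAddCommGroup E] [NormedSpace ℝ E]
    (O : Set E) (hO : IsOpen O) (f : E → E) (hf : ContDiffOn ℝ (⊤ : ℕ∞) f O)
    (k : ℕ) (hk : 1 ≤ k) (x : E) (hx : x ∈ O) (y : E) (ξ : ℕ → E)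
    (j : ℕ) (hj1 : 1 ≤ j) (hjk : j ≤ k) :
    let c : ℝ → ℝ → E := fun t s => x + s • y + ∑ m ∈ Finset.Icc 1 k, t ^ m • ξ m
    let cfam : ℕ → ℝ → ℝ → ℝ → E := fun i t s h =>
      if i = 1 then x + h • ξ 1 + s • y + ∑ m ∈ Finset.Icc 1 k, t ^ m • ξ m
      else x + s • y + (∑ m ∈ Finset.Icc 1 k, t ^ m • ξ m) + ((i : ℝ) * h * t ^ (i - 1)) • ξ i
    deriv (fun h =>
        iteratedDeriv (j - 1) (fun t => ∑ i ∈ Finset.Icc 1 k, f (cfam i t 0 h)) 0) 0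
      = iteratedDeriv j (fun t => f (c t 0)) 0 := by
  intro c cfam
  obtain ⟨n, rfl⟩ : ∃ n, j = n + 1 := ⟨j - 1, by omega⟩
  have hfam : ∀ i ∈ Finset.Icc 1 k, ∀ t h,
      cfam i t 0 h = c t 0 + h • (((i : ℝ) * t ^ (i - 1)) • ξ i) := by
    intro i hi t h
    simp only [cfam, c]
    split_ifs with h1
    · subst h1
      simp
      abel
    · rw [smul_smul]
      congr 2
      ring
  have hc : ContDiff ℝ (⊤ : ℕ∞) (fun t => c t 0) := by
    simp only [c]
    fun_prop
  have hc0 : c 0 0 = x := by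
    simp only [c]
    rw [Finset.sum_eq_zero]
    · simp
    · intro m hm
      have : m ≠ 0 := by have := (Finset.mem_Icc.1 hm).1; omega
      simp [this]
  have hc' : ∀ t, HasDerivAt (fun t => c t 0)
      (∑ i ∈ Finset.Icc 1 k, ((i : ℝ) * t ^ (i - 1)) • ξ i) t := by
    intro t
    simp only [c]
    refine HasDerivAt.const_add _ ?_
    refine HasDerivAt.fun_sum fun i _ => ?_
    exact (hasDerivAt_pow i t).smul_const (ξ i)
  let g : ℕ → ℝ × ℝ → E := fun i p => c p.1 0 + p.2 • (((i : ℝ) * p.1 ^ (i - 1)) • ξ i)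
  have hg : ∀ i, ContDiff ℝ (⊤ : ℕ∞) (g i) := by
    intro i
    have := hc.comp (contDiff_fst (𝕜 := ℝ) (E := ℝ) (F := ℝ))
    refine ContDiff.add this ?_
    fun_prop
  let U : Set (ℝ × ℝ) := ⋂ i ∈ Finset.Icc 1 k, g i ⁻¹' O
  have hU : IsOpen U := isOpen_biInter_finset fun i _ => hO.preimage (hg i).continuous
  have h0 : ((0 : ℝ), (0 : ℝ)) ∈ U := by
    simp only [U, Set.mem_iInter]
    intro i _
    simp [g, hc0, hx]
  have hfO : ∀ z ∈ O, ContDiffAt ℝ (⊤ : ℕ∞) f z := fun z hz => hf.contDiffAt (hO.mem_nhds hz)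
  let G : ℝ × ℝ → E := fun p => ∑ i ∈ Finset.Icc 1 k, f (g i p)
  have hG : ∀ p ∈ U, ContDiffAt ℝ (⊤ : ℕ∞) G p := by
    intro p hp
    refine ContDiffAt.sum fun i hi => ?_
    have : g i p ∈ O := by
      simp only [U, Set.mem_iInter] at hp
      exact hp i hi
    exact (hfO _ this).comp p (hg i).contDiffAt
  have key := aux_comm U hU n G hG 0 0 h0
  have hL : (fun h => iteratedDeriv (n + 1 - 1)
      (fun t => ∑ i ∈ Finset.Icc 1 k, f (cfam i t 0 h)) 0)
      = fun h => iteratedDeriv n (fun t => G (t, h)) 0 := by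
    funext h
    rw [Nat.add_sub_cancel]
    congr 1
    funext t
    exact Finset.sum_congr rfl fun i hi => by rw [hfam i hi]
  rw [hL, key, iteratedDeriv_succ']
  apply Filter.EventuallyEq.iteratedDeriv_eq
  have hev : ∀ᶠ t in nhds (0 : ℝ), c t 0 ∈ O :=
    hc.continuous.continuousAt.eventually (hO.mem_nhds (by simpa only [hc0] using hx))
  filter_upwards [hev] with t ht
  have hfd : HasFDerivAt f (fderiv ℝ f (c t 0)) (c t 0) :=
    ((hfO _ ht).differentiableAt (by simp)).hasFDerivAt
  have hr : HasDerivAt (fun t => f (c t 0)) _ t := hfd.comp_hasDerivAt t (hc' t)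
  rw [hr.deriv, map_sum]
  refine HasDerivAt.deriv ?_
  refine HasDerivAt.fun_sum fun i _ => ?_
  have hl : HasDerivAt (fun h : ℝ => c t 0 + h • (((i : ℝ) * t ^ (i - 1)) • ξ i))
      (((i : ℝ) * t ^ (i - 1)) • ξ i) 0 := by
    simpa using ((hasDerivAt_id (0 : ℝ)).smul_const (((i : ℝ) * t ^ (i - 1)) • ξ i)).const_add (c t 0)
  exact HasFDerivAt.comp_hasDerivAt (0 : ℝ) (by simpa [g] using hfd) hl
end

section
/- Assume the order-1 compatibility condition holds: for all x ∈ O and ξ, y ∈ E, Dg(x)(Γ_M(x)(ξ,y)) = D²g(x)(ξ,y) + Γ_N(g(x))(Dg(x)ξ, Dg(x)y). Fix (x, ξ_1, …, ξ_k) ∈ O × E^k and (y, η_1, …, η_k) ∈ E^{k+1}, and define c̄(t,s) = x + s·y + Σ_{i=1}^{k} t^i·(ξ_i + s·η_i), γ̄(t) = c̄(t,0), ȳ = ∂/∂s (g∘c̄)(0,0), η̄_j = (1/j!)·∂/∂s ∂^j/∂t^j (g∘c̄)(0,0), and ū_j = ( (g∘γ̄)(0), (g∘γ̄)^(1)(0),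 …, (1/j!)(g∘γ̄)^(j)(0) ) ∈ O′ × (E′)^j. Then for every 1 ≤ i ≤ k: Dg(x)( η_i + M^1(x,ξ_1)η_{i-1} + M^2(x,ξ_1,ξ_2)η_{i-2} + ⋯ + M^{i-1}(x,ξ_1,…,ξ_{i-1})η_1 + M^i(x,ξ_1,…,ξ_i)y ) = η̄_i + N^1(ū_1)η̄_{i-1} + N^2(ū_2)η̄_{i-2} + ⋯ + N^{i-1}(ū_{i-1})η̄_1 + N^i(ū_i)ȳ. (Lifts of g-related linear connections to higher order tangent bundles remain g-related: the induced connection-map components satisfy the compatibility condition at every order i ≤ k.) -/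
/-- The induced connection-map components `M^i : O × E^i → L(E,E)` of a Christoffel
symbol `Γ`, defined recursively by `M^1(x,ξ₁)y = Γ x ξ₁ y` and, for `i ≥ 2`,
`M^i(x,ξ₁,…,ξ_i) = (1/i) • ( ∑_{j=1}^{i} D_j M^{i-1}(x,ξ₁,…,ξ_{i-1}) (j•ξ_j) + Γ x ξ₁ ∘ M^{i-1}(x,ξ₁,…,ξ_{i-1}) )`,
where `D_1` is the partial derivative in the `x`-argument (direction `1•ξ₁`) and, for
`2 ≤ j ≤ i`, `D_j` is the partial derivative in the `ξ_{j-1}`-argument (direction `j•ξ_j`).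
The tuple `(ξ₁,…,ξ_{i})` is encoded as a function `ξ : ℕ → E`; `M^i` only reads the
values `ξ 1, …, ξ i`. -/
noncomputable def inducedM {E : Type*} [NormedAddCommGroup E] [NormedSpace ℝ E]
    (Γ : E → (E →L[ℝ] E →L[ℝ] E)) : ℕ → E → (ℕ → E) → (E →L[ℝ] E)
  | 0, _, _ => 0
  | 1, x, ξ => Γ x (ξ 1)
  | (n + 2), x, ξ =>
      (((n + 2 : ℕ) : ℝ))⁻¹ •
        ((fderiv ℝ (fun x' => inducedM Γ (n + 1) x' ξ) x) ((1 : ℝ) • ξ 1)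
          + (∑ j ∈ Finset.Icc 2 (n + 2),
              (fderiv ℝ (fun v => inducedM Γ (n + 1) x (Function.update ξ (j - 1) v))
                  (ξ (j - 1))) ((j : ℝ) • ξ j))
          + (Γ x (ξ 1)).comp (inducedM Γ (n + 1) x ξ))


open scoped ContDiff
open Function

namespace LiftConn

universe u v

theorem inducedM_congr {E : Type*} [NormedAddCommGroup E] [NormedSpace ℝ E]
    (Γ : E → (E →L[ℝ] E →L[ℝ] E)) (m : ℕ) : ∀ (x : E) (ξ ζ : ℕ → E),
    (∀ j, 1 ≤ j → j ≤ m → ξ j = ζ j) → inducedM Γ m x ξ = inducedM Γ m x ζ := by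
  induction m with
  | zero => intro x ξ ζ h; simp [inducedM]
  | succ n ih =>
    intro x ξ ζ h
    cases n with
    | zero => simp [inducedM, h 1 le_rfl le_rfl]
    | succ n =>
      have h1 : ∀ x', inducedM Γ (n+1) x' ξ = inducedM Γ (n+1) x' ζ := fun x' =>
        ih x' ξ ζ (fun j a b => h j a (by omega))
      simp only [inducedM]
      rw [h 1 le_rfl (by omega)]
      simp only [h1]
      congr 3
      apply Finset.sum_congr rfl
      intro j hj
      rw [Finset.mem_Icc] at hj
      rw [h j (by omega) (by omega), h (j-1) (by omega) (by omega)]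
      congr 2
      funext v
      apply ih
      intro l a b
      by_cases hl : l = j - 1
      · subst hl; simp
      · simp [Function.update_of_ne hl, h l a (by omega)]

theorem inducedM_contDiffAt {E : Type u} [NormedAddCommGroup E] [NormedSpace ℝ E]
    (Γ : E → (E →L[ℝ] E →L[ℝ] E)) (O : Set E) (hΓ : ∀ x ∈ O, ContDiffAt ℝ ∞ Γ x) (m : ℕ) :
    ∀ {F : Type u} [NormedAddCommGroup F] [NormedSpace ℝ F] (a : F → E) (b : ℕ → F → E) (p : F),
      a p ∈ O → ContDiffAt ℝ ∞ a p → (∀ j, ContDiffAt ℝ ∞ (b j) p) →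
      ContDiffAt ℝ ∞ (fun q => inducedM Γ m (a q) (fun j => b j q)) p := by
  induction m with
  | zero => intro F _ _ a b p _ _ _; simp only [inducedM]; exact contDiffAt_const
  | succ n ih =>
    intro F _ _ a b p hp ha hb
    have hΓa : ContDiffAt ℝ ∞ (fun q => Γ (a q) (b 1 q)) p :=
      ((hΓ _ hp).comp p ha).clm_apply (hb 1)
    cases n with
    | zero => simpa only [inducedM] using hΓa
    | succ n =>
      simp only [inducedM]
      apply ContDiffAt.const_smul
      apply ContDiffAt.add
      apply ContDiffAt.add
      · apply ContDiffAt.clm_apply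
        · apply ContDiffAt.fderiv (f := fun q x' => inducedM Γ (n+1) x' (fun j => b j q))
            (n := ∞) _ ha (by simp)
          exact ih (F := F × E) (fun q => q.2) (fun j q => b j q.1) (p, a p) hp
            contDiffAt_snd (fun j => (hb j).comp (p, a p) contDiffAt_fst)
        · exact (hb 1).const_smul _
      · apply ContDiffAt.sum
        intro j hj
        apply ContDiffAt.clm_apply
        · apply ContDiffAt.fderiv (f := fun q v => inducedM Γ (n+1) (a q)
            (Function.update (fun j => b j q) (j-1) v))
            (n := ∞) _ (hb _) (by simp)
          have := ih (F := F × E) (fun q => a q.1)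
            (fun l q => if l = j - 1 then q.2 else b l q.1) (p, b (j-1) p) hp
            (ha.comp (p, b (j-1) p) contDiffAt_fst) (fun l => by
              by_cases hl : l = j - 1
              · simp only [hl, if_true]; exact contDiffAt_snd
              · simp only [hl, if_false]; exact (hb l).comp (p, b (j-1) p) contDiffAt_fst)
          convert this using 1
          funext q
          simp only [Function.uncurry]
          congr 1
          funext l
          simp [Function.update_apply]
        · exact (hb j).const_smul _
      · exact hΓa.clm_comp (ih a b p hp ha hb)

/-- Chain rule. -/
theorem inducedM_hasDerivAt {E : Type u} [NormedAddCommGroup E] [NormedSpace ℝ E]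
    (Γ : E → (E →L[ℝ] E →L[ℝ] E)) (O : Set E) (hΓ : ∀ x ∈ O, ContDiffAt ℝ ∞ Γ x) (m : ℕ)
    (c : ℝ → E) (w : ℕ → ℝ → E) (c' : E) (w' : ℕ → E) (t : ℝ) (ht : c t ∈ O)
    (hc : HasDerivAt c c' t) (hw : ∀ j, HasDerivAt (w j) (w' j) t) :
    HasDerivAt (fun r => inducedM Γ m (c r) (fun j => w j r))
      (fderiv ℝ (fun x' => inducedM Γ m x' (fun j => w j t)) (c t) c'
        + ∑ j ∈ Finset.Icc 1 m, fderiv ℝ (fun v => inducedM Γ m (c t)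
            (Function.update (fun j => w j t) j v)) (w j t) (w' j)) t := by
  let ext : (Fin (m+1) → E) → ℕ → E := fun v j => if h : j < m + 1 then v ⟨j, h⟩ else 0
  let Φ : E × (Fin (m+1) → E) → (E →L[ℝ] E) := fun q => inducedM Γ m q.1 (ext q.2)
  let w0 : Fin (m+1) → E := fun j => w j t
  have hΦ : ContDiffAt ℝ ∞ Φ (c t, w0) := by
    apply inducedM_contDiffAt Γ O hΓ m (fun q : E × (Fin (m+1) → E) => q.1)
      (fun j q => ext q.2 j) (c t, w0) ht contDiffAt_fst
    intro j
    by_cases h : j < m + 1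
    · simp only [ext, h, dif_pos]
      fun_prop
    · simp only [ext, h, dif_neg, not_false_eq_true]
      exact contDiffAt_const
  have hd : HasFDerivAt Φ (fderiv ℝ Φ (c t, w0)) (c t, w0) :=
    (hΦ.differentiableAt (by simp)).hasFDerivAt
  have hcurve : HasDerivAt (fun r => (c r, fun j : Fin (m+1) => w j r))
      (c', fun j : Fin (m+1) => w' j) t :=
    hc.prodMk (hasDerivAt_pi.2 fun j => hw j)
  have key := hd.comp_hasDerivAt t hcurve
  have hx : fderiv ℝ (fun x' => inducedM Γ m x' (fun j => w j t)) (c t) c'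
      = fderiv ℝ Φ (c t, w0) (c', 0) := by
    have h1 : HasFDerivAt (fun x' : E => (x', w0)) (ContinuousLinearMap.inl ℝ E _) (c t) :=
      hasFDerivAt_prodMk_left _ _
    have h2 := hd.comp (c t) h1
    have h3 : (fun x' => inducedM Γ m x' (fun j => w j t)) = Φ ∘ (fun x' : E => (x', w0)) := by
      funext x'
      apply inducedM_congr
      intro j _ hj
      simp only [ext, w0, dif_pos (Nat.lt_succ_of_le hj)]
    rw [h3, h2.fderiv]
    simp
  have hj : ∀ (j : ℕ) (hj1 : 1 ≤ j) (hjm : j < m + 1), fderiv ℝ (fun v => inducedM Γ m (c t)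
            (Function.update (fun j => w j t) j v)) (w j t) (w' j)
      = fderiv ℝ Φ (c t, w0) (0, Pi.single ⟨j, hjm⟩ (w' j)) := by
    intro j hj1 hjm
    have h1 : HasFDerivAt (fun v : E => (c t, Function.update w0 ⟨j, hjm⟩ v))
        ((0 : E →L[ℝ] E).prod (ContinuousLinearMap.pi (Pi.single ⟨j, hjm⟩ (.id ℝ E)))) (w j t) :=
      (hasFDerivAt_const _ _).prodMk (hasFDerivAt_update w0 (w j t))
    have hw0 : Function.update w0 ⟨j, hjm⟩ (w j t) = w0 := by
      simp [w0]
    have h2 : HasFDerivAt Φ (fderiv ℝ Φ (c t, w0))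
      ((fun v : E => (c t, Function.update w0 ⟨j, hjm⟩ v)) (w j t)) := by
      simp only [hw0]; exact hd
    have h2 := h2.comp (w j t) h1
    have h3 : (fun v => inducedM Γ m (c t) (Function.update (fun j => w j t) j v))
        = Φ ∘ (fun v : E => (c t, Function.update w0 ⟨j, hjm⟩ v)) := by
      funext v
      apply inducedM_congr
      intro l _ hl
      simp only [ext, w0, dif_pos (Nat.lt_succ_of_le hl), Function.update_apply, Fin.mk.injEq]
    rw [h3, h2.fderiv]
    simp only [ContinuousLinearMap.comp_apply, ContinuousLinearMap.prod_apply]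
    congr 2
    funext l
    by_cases hl : l = ⟨j, hjm⟩
    · subst hl; simp
    · simp [Pi.single_eq_of_ne hl]
  have h0 : fderiv ℝ Φ (c t, w0) (0, Pi.single 0 (w' 0)) = 0 := by
    have h1 : HasFDerivAt (fun v : E => (c t, Function.update w0 0 v))
        ((0 : E →L[ℝ] E).prod (ContinuousLinearMap.pi (Pi.single 0 (.id ℝ E)))) (w 0 t) :=
      (hasFDerivAt_const _ _).prodMk (hasFDerivAt_update w0 (w 0 t))
    have hw0 : Function.update w0 0 (w 0 t) = w0 := by
      have := Function.update_eq_self (0 : Fin (m+1)) w0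
      simpa [w0] using this
    have h2 : HasFDerivAt Φ (fderiv ℝ Φ (c t, w0))
      ((fun v : E => (c t, Function.update w0 0 v)) (w 0 t)) := by
      simp only [hw0]; exact hd
    have h2 := h2.comp (w 0 t) h1
    have h3 : Φ ∘ (fun v : E => (c t, Function.update w0 0 v)) = fun _ => Φ (c t, w0) := by
      funext v
      apply inducedM_congr
      intro l hl1 hl
      have : (⟨l, Nat.lt_succ_of_le hl⟩ : Fin (m+1)) ≠ 0 := by
        intro h; have := congrArg Fin.val h; simp at this; omega
      simp only [ext, dif_pos (Nat.lt_succ_of_le hl), Function.update_of_ne this]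
    rw [h3] at h2
    have h4 := h2.unique (hasFDerivAt_const _ _)
    have h5 := DFunLike.congr_fun h4 (w' 0)
    simp only [ContinuousLinearMap.comp_apply, ContinuousLinearMap.prod_apply] at h5
    rw [ContinuousLinearMap.zero_apply, ContinuousLinearMap.zero_apply] at h5
    rw [← h5]
    congr 2
    funext l
    by_cases hl : l = 0
    · subst hl; simp
    · simp [Pi.single_eq_of_ne hl]
  have hsum : (c', fun j : Fin (m+1) => w' j) = (c', 0) +
      ∑ j : Fin (m+1), ((0 : E), (Pi.single j (w' j) : Fin (m+1) → E)) := by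
    ext1
    · simp [Prod.fst_sum]
    · simp only [Prod.snd_add, Prod.snd_sum, zero_add]
      exact (Finset.univ_sum_single (fun j : Fin (m+1) => w' j)).symm
  rw [hsum, map_add, map_sum] at key
  have hval : fderiv ℝ (fun x' => inducedM Γ m x' (fun j => w j t)) (c t) c'
        + ∑ j ∈ Finset.Icc 1 m, fderiv ℝ (fun v => inducedM Γ m (c t)
            (Function.update (fun j => w j t) j v)) (w j t) (w' j)
      = fderiv ℝ Φ (c t, w0) (c', 0) + ∑ j : Fin (m+1), fderiv ℝ Φ (c t, w0)
          (0, Pi.single j (w' j)) := by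
    rw [hx]
    congr 1
    have e : ∀ j : Fin (m+1), fderiv ℝ Φ (c t, w0) (0, Pi.single j (w' j))
       = (fun l : ℕ => if l = 0 then 0 else fderiv ℝ (fun v => inducedM Γ m (c t)
            (Function.update (fun j => w j t) l v)) (w l t) (w' l)) (j : ℕ) := by
      intro j
      by_cases h : j = 0
      · subst h; simpa using h0
      · have h' : (j : ℕ) ≠ 0 := fun h' => h (Fin.ext h')
        simp only [h', if_false]
        rw [hj j (by omega) j.2]
    rw [Finset.sum_congr rfl (fun j _ => e j), Fin.sum_univ_eq_sum_range (fun l : ℕ => if l = 0 then 0 else fderiv ℝ (fun v => inducedM Γ m (c t)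
            (Function.update (fun j => w j t) l v)) (w l t) (w' l)) (m+1)]
    symm
    rw [← Finset.sum_subset (s₁ := Finset.Icc 1 m)]
    · apply Finset.sum_congr rfl
      intro l hl
      rw [Finset.mem_Icc] at hl
      rw [if_neg (by omega)]
    · intro l hl; rw [Finset.mem_Icc] at hl; rw [Finset.mem_range]; omega
    · intro l hl hl'
      rw [Finset.mem_range] at hl; rw [Finset.mem_Icc] at hl'
      rw [if_pos (by omega)]
  rw [hval]
  have hfun : (fun r => inducedM Γ m (c r) (fun j => w j r))
      = Φ ∘ fun r => (c r, fun j : Fin (m+1) => w j r) := by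
    funext r
    apply inducedM_congr
    intro j _ hj
    simp only [ext, dif_pos (Nat.lt_succ_of_le hj)]
  rw [hfun]
  exact key

/-- Taylor coefficient curves. -/
noncomputable def tc {E : Type*} [NormedAddCommGroup E] [NormedSpace ℝ E]
    (γ : ℝ → E) (j : ℕ) (t : ℝ) : E := ((Nat.factorial j : ℝ))⁻¹ • iteratedDeriv j γ t

theorem tc_hasDerivAt {E : Type*} [NormedAddCommGroup E] [NormedSpace ℝ E]
    (γ : ℝ → E) (j : ℕ) (t : ℝ) (h : ContDiffAt ℝ ∞ γ t) :
    HasDerivAt (tc γ j) (((j + 1 : ℕ) : ℝ) • tc γ (j+1) t) t := by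
  have h1 : DifferentiableAt ℝ (iteratedDeriv j γ) t := by
    have h0 := h.differentiableAt_iteratedFDeriv (m := j) (by exact_mod_cast ENat.coe_lt_top j)
    rw [iteratedDeriv_eq_equiv_comp]
    exact (LinearIsometryEquiv.differentiableAt _).comp t h0
  have h2 := (h1.hasDerivAt.const_smul ((Nat.factorial j : ℝ))⁻¹)
  suffices e : ((j + 1 : ℕ) : ℝ) • tc γ (j+1) t
      = ((Nat.factorial j : ℝ))⁻¹ • deriv (iteratedDeriv j γ) t by
    rw [e]
    exact h2
  rw [tc, iteratedDeriv_succ, smul_smul]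
  congr 1
  have : (Nat.factorial j : ℝ) ≠ 0 := by positivity
  rw [Nat.factorial_succ]
  push_cast
  field_simp

/-- The connection components along a curve. -/
noncomputable def cA {E : Type*} [NormedAddCommGroup E] [NormedSpace ℝ E]
    (Γ : E → (E →L[ℝ] E →L[ℝ] E)) (γ : ℝ → E) : ℕ → ℝ → (E →L[ℝ] E)
  | 0, _ => ContinuousLinearMap.id ℝ E
  | (n+1), t => inducedM Γ (n+1) (γ t) (fun j => tc γ j t)

theorem cA_hasDerivAt {E : Type u} [NormedAddCommGroup E] [NormedSpace ℝ E]
    (Γ : E → (E →L[ℝ] E →L[ℝ] E)) (O : Set E) (hΓ : ∀ x ∈ O, ContDiffAt ℝ ∞ Γ x)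
    (γ : ℝ → E) (t : ℝ) (ht : γ t ∈ O) (hγ : ContDiffAt ℝ ∞ γ t) (m : ℕ) :
    HasDerivAt (cA Γ γ m) (((m + 1 : ℕ) : ℝ) • cA Γ γ (m+1) t
      - (Γ (γ t) (tc γ 1 t)).comp (cA Γ γ m t)) t := by
  cases m with
  | zero =>
    have : ((0 + 1 : ℕ) : ℝ) • cA Γ γ (0+1) t
      - (Γ (γ t) (tc γ 1 t)).comp (cA Γ γ 0 t) = 0 := by
      simp [cA, inducedM]
    rw [this]
    exact hasDerivAt_const _ _
  | succ m =>
    have h := inducedM_hasDerivAt Γ O hΓ (m+1) γ (tc γ) (tc γ 1 t)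
      (fun j => ((j + 1 : ℕ) : ℝ) • tc γ (j+1) t) t ht
      (by have := (hγ.differentiableAt (by simp)).hasDerivAt
          simpa [tc] using this) (fun j => tc_hasDerivAt γ j t hγ)
    have hh : cA Γ γ (m+1) = (fun r => inducedM Γ (m+1) (γ r) (fun j => tc γ j r)) := by
      funext r; rfl
    rw [hh]
    convert h using 1
    have hne : ((m + 1 + 1 : ℕ) : ℝ) ≠ 0 := by positivity
    simp only [cA, inducedM]
    rw [smul_smul, mul_inv_cancel₀ hne, one_smul, one_smul, add_sub_cancel_right]
    congr 1
    have : Finset.Icc 2 (m+2) = (Finset.Icc 1 (m+1)).map (addRightEmbedding 1) := by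
      rw [Finset.map_add_right_Icc]
    rw [this, Finset.sum_map]
    apply Finset.sum_congr rfl
    intro j _
    simp

/-- `S i`. -/
noncomputable def cS {E : Type*} [NormedAddCommGroup E] [NormedSpace ℝ E]
    (Γ : E → (E →L[ℝ] E →L[ℝ] E)) (γ Y : ℝ → E) (i : ℕ) (t : ℝ) : E :=
  ∑ p ∈ Finset.HasAntidiagonal.antidiagonal i, cA Γ γ p.1 t (tc Y p.2 t)

theorem cS_hasDerivAt {E : Type u} [NormedAddCommGroup E] [NormedSpace ℝ E]
    (Γ : E → (E →L[ℝ] E →L[ℝ] E)) (O : Set E) (hΓ : ∀ x ∈ O, ContDiffAt ℝ ∞ Γ x)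
    (γ Y : ℝ → E) (t : ℝ) (ht : γ t ∈ O) (hγ : ContDiffAt ℝ ∞ γ t) (hY : ContDiffAt ℝ ∞ Y t)
    (i : ℕ) :
    HasDerivAt (cS Γ γ Y i) (((i + 1 : ℕ) : ℝ) • cS Γ γ Y (i+1) t
      - Γ (γ t) (deriv γ t) (cS Γ γ Y i t)) t := by
  have h : HasDerivAt (cS Γ γ Y i) (∑ p ∈ Finset.HasAntidiagonal.antidiagonal i,
      ((((p.1 + 1 : ℕ) : ℝ) • cA Γ γ (p.1+1) t
      - (Γ (γ t) (tc γ 1 t)).comp (cA Γ γ p.1 t)) (tc Y p.2 t)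
        + cA Γ γ p.1 t (((p.2 + 1 : ℕ) : ℝ) • tc Y (p.2+1) t))) t := by
    apply HasDerivAt.fun_sum
    intro p _
    exact (cA_hasDerivAt Γ O hΓ γ t ht hγ p.1).clm_apply (tc_hasDerivAt Y p.2 t hY)
  convert h using 1
  have h1 : deriv γ t = tc γ 1 t := by simp [tc]
  rw [h1]
  have h2 : ((i + 1 : ℕ) : ℝ) • cS Γ γ Y (i+1) t =
      ∑ p ∈ Finset.HasAntidiagonal.antidiagonal (i+1), (p.1 : ℝ) • cA Γ γ p.1 t (tc Y p.2 t)
      + ∑ p ∈ Finset.HasAntidiagonal.antidiagonal (i+1), (p.2 : ℝ) • cA Γ γ p.1 t (tc Y p.2 t) := by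
    rw [cS, Finset.smul_sum, ← Finset.sum_add_distrib]
    apply Finset.sum_congr rfl
    intro p hp
    rw [← add_smul, ← Finset.HasAntidiagonal.mem_antidiagonal.1 hp]
    push_cast
    rfl
  rw [h2, Finset.Nat.sum_antidiagonal_succ, Finset.Nat.sum_antidiagonal_succ', cS, map_sum]
  simp only [Nat.cast_zero, zero_smul, zero_add, add_zero]
  rw [← Finset.sum_add_distrib, ← Finset.sum_sub_distrib]
  apply Finset.sum_congr rfl
  intro p _
  simp only [ContinuousLinearMap.sub_apply, ContinuousLinearMap.smul_apply,
    ContinuousLinearMap.comp_apply, map_smul]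
  abel

theorem cS_related {E : Type u} {E' : Type v} [NormedAddCommGroup E] [NormedSpace ℝ E]
    [NormedAddCommGroup E'] [NormedSpace ℝ E']
    (O : Set E) (O' : Set E')
    (g : E → E') (hg : ∀ x ∈ O, ContDiffAt ℝ ∞ g x) (hmaps : Set.MapsTo g O O')
    (ΓM : E → (E →L[ℝ] E →L[ℝ] E)) (hΓM : ∀ x ∈ O, ContDiffAt ℝ ∞ ΓM x)
    (ΓN : E' → (E' →L[ℝ] E' →L[ℝ] E')) (hΓN : ∀ x ∈ O', ContDiffAt ℝ ∞ ΓN x)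
    (hcompat : ∀ x ∈ O, ∀ ξ y : E,
      fderiv ℝ g x (ΓM x ξ y)
        = fderiv ℝ (fderiv ℝ g) x ξ y
          + ΓN (g x) (fderiv ℝ g x ξ) (fderiv ℝ g x y))
    (U : Set ℝ) (hU : IsOpen U) (γ Y : ℝ → E) (hγU : ∀ t ∈ U, γ t ∈ O)
    (hγ : ∀ t ∈ U, ContDiffAt ℝ ∞ γ t) (hY : ∀ t ∈ U, ContDiffAt ℝ ∞ Y t) (i : ℕ) :
    ∀ t ∈ U, fderiv ℝ g (γ t) (cS ΓM γ Y i t)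
      = cS ΓN (fun r => g (γ r)) (fun r => fderiv ℝ g (γ r) (Y r)) i t := by
  induction i with
  | zero => intro t ht; simp [cS, cA, tc]
  | succ i ih =>
    intro t ht
    have hgt := hg _ (hγU t ht)
    have hfd : ContDiffAt ℝ ∞ (fderiv ℝ g) (γ t) := hgt.fderiv_right (by simp)
    have hγd := ((hγ t ht).differentiableAt (by simp)).hasDerivAt
    have hδ : ContDiffAt ℝ ∞ (fun r => g (γ r)) t := hgt.comp t (hγ t ht)
    have hDγ : ContDiffAt ℝ ∞ (fun r => fderiv ℝ g (γ r)) t := hfd.comp t (hγ t ht)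
    have hZ : ContDiffAt ℝ ∞ (fun r => fderiv ℝ g (γ r) (Y r)) t :=
      hDγ.clm_apply (hY t ht)
    have hM := cS_hasDerivAt ΓM O hΓM γ Y t (hγU t ht) (hγ t ht) (hY t ht) i
    have hN := cS_hasDerivAt ΓN O' hΓN _ _ t (hmaps (hγU t ht)) hδ hZ i
    have hDγ' : HasDerivAt (fun r => fderiv ℝ g (γ r)) (fderiv ℝ (fderiv ℝ g) (γ t) (deriv γ t)) t :=
      (hfd.differentiableAt (by simp)).hasFDerivAt.comp_hasDerivAt t hγd
    have hL := hDγ'.clm_apply hM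
    have hδ' : HasDerivAt (fun r => g (γ r)) (fderiv ℝ g (γ t) (deriv γ t)) t :=
      (hgt.differentiableAt (by simp)).hasFDerivAt.comp_hasDerivAt t hγd
    have hev : (fun r => fderiv ℝ g (γ r) (cS ΓM γ Y i r)) =ᶠ[nhds t]
        cS ΓN (fun r => g (γ r)) (fun r => fderiv ℝ g (γ r) (Y r)) i :=
      Filter.eventually_of_mem (hU.mem_nhds ht) ih
    have heq := (hL.congr_of_eventuallyEq hev.symm).unique hN
    rw [hδ'.deriv, ← ih t ht, map_sub, hcompat _ (hγU t ht), map_smul] at heq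
    have hne : ((i + 1 : ℕ) : ℝ) ≠ 0 := by positivity
    apply smul_right_injective E' hne
    simp only
    have h3 : ∀ a b c d : E', a + (b - (a + c)) = d - c → b = d := by
      intro a b c d h
      have : b - c = d - c := by rw [← h]; abel
      exact sub_left_injective this
    exact h3 _ _ _ _ heq

theorem swap_one {E : Type*} [NormedAddCommGroup E] [NormedSpace ℝ E]
    (F : ℝ × ℝ → E) (a b : ℝ) (h : ContDiffAt ℝ ∞ F (a, b)) :
    deriv (fun s => fderiv ℝ F (a, s) (1, 0)) b
      = deriv (fun t => fderiv ℝ F (t, b) (0, 1)) a := by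
  have hd : ContDiffAt ℝ ∞ (fderiv ℝ F) (a, b) := h.fderiv_right (by simp)
  have hd' := (hd.differentiableAt (by simp)).hasFDerivAt
  have hs : HasDerivAt (fun s : ℝ => (a, s)) ((0 : ℝ), (1 : ℝ)) b :=
    (hasDerivAt_const _ _).prodMk (hasDerivAt_id _)
  have ht : HasDerivAt (fun t : ℝ => (t, b)) ((1 : ℝ), (0 : ℝ)) a :=
    (hasDerivAt_id _).prodMk (hasDerivAt_const _ _)
  have h1 : HasDerivAt (fun s => fderiv ℝ F (a, s)) (fderiv ℝ (fderiv ℝ F) (a, b) (0, 1)) b :=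
    HasFDerivAt.comp_hasDerivAt (f := fun s : ℝ => (a, s)) b hd' hs
  have h2 : HasDerivAt (fun t => fderiv ℝ F (t, b)) (fderiv ℝ (fderiv ℝ F) (a, b) (1, 0)) a :=
    HasFDerivAt.comp_hasDerivAt (f := fun t : ℝ => (t, b)) a hd' ht
  have e1 := (h1.clm_apply (hasDerivAt_const b ((1 : ℝ), (0 : ℝ)))).deriv
  have e2 := (h2.clm_apply (hasDerivAt_const a ((0 : ℝ), (1 : ℝ)))).deriv
  rw [map_zero, add_zero] at e1 e2
  rw [e1, e2]
  have hsymm : IsSymmSndFDerivAt ℝ F (a, b) := h.isSymmSndFDerivAt (by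
    rw [minSmoothness_of_isRCLikeNormedField]
    first | exact WithTop.coe_le_coe.2 (le_top : (2 : ℕ∞) ≤ ⊤) | simp)
  exact hsymm (0, 1) (1, 0)

theorem swap_iter {E : Type*} [NormedAddCommGroup E] [NormedSpace ℝ E]
    (W : Set (ℝ × ℝ)) (hW : IsOpen W) (n : ℕ) :
    ∀ (F : ℝ × ℝ → E) (_ : ∀ p ∈ W, ContDiffAt ℝ ∞ F p) (p : ℝ × ℝ) (_ : p ∈ W),
    deriv (fun s => iteratedDeriv n (fun t => F (t, s)) p.1) p.2
      = iteratedDeriv n (fun t => fderiv ℝ F (t, p.2) (0, 1)) p.1 := by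
  have pt : ∀ (F : ℝ × ℝ → E) (p : ℝ × ℝ), ContDiffAt ℝ ∞ F p →
      deriv (fun t => F (t, p.2)) p.1 = fderiv ℝ F p (1, 0) := by
    intro F p h
    have ht : HasDerivAt (fun t : ℝ => (t, p.2)) ((1 : ℝ), (0 : ℝ)) p.1 :=
      (hasDerivAt_id _).prodMk (hasDerivAt_const _ _)
    exact ((h.differentiableAt (by simp)).hasFDerivAt.comp_hasDerivAt p.1 ht).deriv
  have ps : ∀ (F : ℝ × ℝ → E) (p : ℝ × ℝ), ContDiffAt ℝ ∞ F p →
      deriv (fun s => F (p.1, s)) p.2 = fderiv ℝ F p (0, 1) := by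
    intro F p h
    have ht : HasDerivAt (fun s : ℝ => (p.1, s)) ((0 : ℝ), (1 : ℝ)) p.2 :=
      (hasDerivAt_const _ _).prodMk (hasDerivAt_id _)
    exact ((h.differentiableAt (by simp)).hasFDerivAt.comp_hasDerivAt p.2 ht).deriv
  have nt : ∀ p ∈ W, ∀ᶠ t in nhds p.1, (t, p.2) ∈ W := fun p hp =>
    (Continuous.prodMk_left p.2).continuousAt.eventually_mem (hW.mem_nhds hp)
  have ns : ∀ p ∈ W, ∀ᶠ s in nhds p.2, (p.1, s) ∈ W := fun p hp =>
    (Continuous.prodMk_right p.1).continuousAt.eventually_mem (hW.mem_nhds hp)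
  induction n with
  | zero => intro F hF p hp; simpa using ps F p (hF p hp)
  | succ n ih =>
    intro F hF p hp
    have hF1 : ∀ q ∈ W, ContDiffAt ℝ ∞ (fun q => fderiv ℝ F q (1, 0)) q := fun q hq =>
      ((hF q hq).fderiv_right (by simp)).clm_apply contDiffAt_const
    have h1 : (fun s => iteratedDeriv (n+1) (fun t => F (t, s)) p.1) =ᶠ[nhds p.2]
        (fun s => iteratedDeriv n (fun t => fderiv ℝ F (t, s) (1, 0)) p.1) := by
      filter_upwards [ns p hp] with s hs
      rw [iteratedDeriv_succ']
      apply Filter.EventuallyEq.iteratedDeriv_eq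
      filter_upwards [nt (p.1, s) hs] with t ht
      exact pt F (t, s) (hF _ ht)
    rw [h1.deriv_eq, ih (fun q => fderiv ℝ F q (1, 0)) hF1 p hp, iteratedDeriv_succ']
    apply Filter.EventuallyEq.iteratedDeriv_eq
    filter_upwards [nt p hp] with t ht
    rw [← ps _ _ (hF1 _ ht)]
    exact swap_one F t p.2 (hF _ ht)

theorem poly_tc {E : Type*} [NormedAddCommGroup E] [NormedSpace ℝ E] (j : ℕ) :
    ∀ (k : ℕ) (a : ℕ → E), j ≤ k →
    iteratedDeriv j (fun t : ℝ => ∑ i ∈ Finset.range (k+1), t ^ i • a i) 0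
      = (Nat.factorial j : ℝ) • a j := by
  induction j with
  | zero =>
    intro k a _
    simp [Finset.sum_range_succ']
  | succ j ih =>
    intro k a hk
    obtain ⟨k, rfl⟩ : ∃ l, k = l + 1 := ⟨k - 1, by omega⟩
    have hd : deriv (fun t : ℝ => ∑ i ∈ Finset.range (k+1+1), t ^ i • a i)
        = fun t : ℝ => ∑ i ∈ Finset.range (k+1), t ^ i • (((i + 1 : ℕ) : ℝ) • a (i+1)) := by
      funext t
      have h : HasDerivAt (fun t : ℝ => ∑ i ∈ Finset.range (k+1+1), t ^ i • a i)
          (∑ i ∈ Finset.range (k+1+1), ((i : ℝ) * t ^ (i - 1)) • a i) t := by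
        apply HasDerivAt.fun_sum
        intro i _
        exact (hasDerivAt_pow i t).smul_const (a i)
      rw [h.deriv, Finset.sum_range_succ']
      simp [smul_smul, mul_comm]
    rw [iteratedDeriv_succ', hd, ih k _ (by omega), smul_smul, Nat.factorial_succ]
    push_cast
    rw [mul_comm]

theorem poly_tc' {E : Type*} [NormedAddCommGroup E] [NormedSpace ℝ E] (j : ℕ)
    (k : ℕ) (x : E) (a : ℕ → E) (hj : j ≤ k) :
    tc (fun t : ℝ => x + ∑ i ∈ Finset.Icc 1 k, t ^ i • a i) j 0 = if j = 0 then x else a j := by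
  have : (fun t : ℝ => x + ∑ i ∈ Finset.Icc 1 k, t ^ i • a i)
      = fun t : ℝ => ∑ i ∈ Finset.range (k+1), t ^ i • (if i = 0 then x else a i) := by
    funext t
    rw [Finset.sum_range_succ']
    have : Finset.Icc 1 k = (Finset.range k).map (addRightEmbedding 1) := by
      rw [Finset.range_eq_Ico, Finset.map_add_right_Ico]; ext; simp only [Finset.mem_Icc, Finset.mem_Ico]; omega
    rw [this, Finset.sum_map]
    simp [add_comm]
  rw [tc, this, poly_tc j k _ hj, smul_smul, inv_mul_cancel₀ (by positivity), one_smul]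

theorem cS_expand {E : Type*} [NormedAddCommGroup E] [NormedSpace ℝ E]
    (Γ : E → (E →L[ℝ] E →L[ℝ] E)) (γ Y : ℝ → E) (i : ℕ) (hi : 1 ≤ i) (t : ℝ) :
    cS Γ γ Y i t = tc Y i t
      + (∑ j ∈ Finset.Icc 1 (i - 1), inducedM Γ j (γ t) (fun l => tc γ l t) (tc Y (i - j) t))
      + inducedM Γ i (γ t) (fun l => tc γ l t) (Y t) := by
  obtain ⟨n, rfl⟩ : ∃ l, i = l + 1 := ⟨i - 1, by omega⟩
  rw [cS, Finset.Nat.sum_antidiagonal_eq_sum_range_succ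
    (fun a b => cA Γ γ a t (tc Y b t)), Finset.sum_range_succ, Finset.sum_range_succ']
  have : Finset.Icc 1 (n+1-1) = (Finset.range n).map (addRightEmbedding 1) := by
    rw [Finset.range_eq_Ico, Finset.map_add_right_Ico]; ext; simp only [Finset.mem_Icc, Finset.mem_Ico]; omega
  rw [this, Finset.sum_map]
  simp only [cA, addRightEmbedding_apply]
  rw [add_comm (∑ _ ∈ _, _)]
  simp [tc]

end LiftConn

/-- **Lifts of `g`-related linear connections remain `g`-related.**
If the Christoffel symbols `Γ_M` and `Γ_N` satisfy the order-1 compatibility condition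
along `g`, then for every order `1 ≤ i ≤ k` the induced connection-map components
`M^i` and `N^i` satisfy the higher-order compatibility condition
`Dg(x)(η_i + M^1 η_{i-1} + ⋯ + M^{i-1} η_1 + M^i y) = η̄_i + N^1 η̄_{i-1} + ⋯ + N^{i-1} η̄_1 + N^i ȳ`. -/
theorem lifted_connections_g_related
    {E E' : Type*} [NormedAddCommGroup E] [NormedSpace ℝ E]
    [NormedAddCommGroup E'] [NormedSpace ℝ E']
    (O : Set E) (O' : Set E') (hO : IsOpen O) (hO' : IsOpen O')
    (g : E → E') (hg : ContDiffOn ℝ (⊤ : ℕ∞) g O) (hmaps : Set.MapsTo g O O')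
    (ΓM : E → (E →L[ℝ] E →L[ℝ] E)) (hΓM : ContDiffOn ℝ (⊤ : ℕ∞) ΓM O)
    (ΓN : E' → (E' →L[ℝ] E' →L[ℝ] E')) (hΓN : ContDiffOn ℝ (⊤ : ℕ∞) ΓN O')
    (hcompat : ∀ x ∈ O, ∀ ξ y : E,
      fderiv ℝ g x (ΓM x ξ y)
        = fderiv ℝ (fderiv ℝ g) x ξ y
          + ΓN (g x) (fderiv ℝ g x ξ) (fderiv ℝ g x y))
    (k : ℕ) (hk : 1 ≤ k) (x : E) (hx : x ∈ O) (ξ : ℕ → E) (y : E) (η : ℕ → E) :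
    let cbar : ℝ → ℝ → E := fun t s => x + s • y + ∑ i ∈ Finset.Icc 1 k, t ^ i • (ξ i + s • η i)
    let γbar : ℝ → E := fun t => cbar t 0
    let ybar : E' := deriv (fun s => g (cbar 0 s)) 0
    let ηbar : ℕ → E' := fun j =>
      ((Nat.factorial j : ℝ))⁻¹ • deriv (fun s => iteratedDeriv j (fun t => g (cbar t s)) 0) 0
    let ubar : ℕ → E' := fun j =>
      ((Nat.factorial j : ℝ))⁻¹ • iteratedDeriv j (fun t => g (γbar t)) 0
    ∀ i : ℕ, 1 ≤ i → i ≤ k →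
      fderiv ℝ g x
          (η i + (∑ j ∈ Finset.Icc 1 (i - 1), inducedM ΓM j x ξ (η (i - j)))
            + inducedM ΓM i x ξ y)
        = ηbar i
          + (∑ j ∈ Finset.Icc 1 (i - 1), inducedM ΓN j (g (γbar 0)) ubar (ηbar (i - j)))
          + inducedM ΓN i (g (γbar 0)) ubar ybar := by
  intro cbar γbar ybar ηbar ubar i hi1 hik
  have hg' : ∀ x ∈ O, ContDiffAt ℝ ∞ g x := fun x hx => hg.contDiffAt (hO.mem_nhds hx)
  have hM' : ∀ x ∈ O, ContDiffAt ℝ ∞ ΓM x := fun x hx => hΓM.contDiffAt (hO.mem_nhds hx)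
  have hN' : ∀ x ∈ O', ContDiffAt ℝ ∞ ΓN x := fun x hx => hΓN.contDiffAt (hO'.mem_nhds hx)
  let Y : ℝ → E := fun t => y + ∑ i ∈ Finset.Icc 1 k, t ^ i • η i
  have hγeq : γbar = fun t => x + ∑ i ∈ Finset.Icc 1 k, t ^ i • ξ i := by
    funext t; simp [γbar, cbar]
  let C : ℝ × ℝ → E := fun p => cbar p.1 p.2
  have hC : ContDiff ℝ ∞ C := by
    simp only [C, cbar]
    fun_prop
  have hγs : ContDiff ℝ ∞ γbar := by rw [hγeq]; fun_prop
  have hYs : ContDiff ℝ ∞ Y := by simp only [Y]; fun_prop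
  have hγ0 : γbar 0 = x := by
    rw [hγeq]; simp only [add_eq_left]
    apply Finset.sum_eq_zero
    intro i hi
    rw [Finset.mem_Icc] at hi
    rw [zero_pow (by omega), zero_smul]
  have hY0 : Y 0 = y := by
    simp only [Y, add_eq_left]
    apply Finset.sum_eq_zero
    intro i hi
    rw [Finset.mem_Icc] at hi
    rw [zero_pow (by omega), zero_smul]
  let U : Set ℝ := γbar ⁻¹' O
  have hU : IsOpen U := hO.preimage hγs.continuous
  have h0U : (0 : ℝ) ∈ U := by show γbar 0 ∈ O; rw [hγ0]; exact hx
  have main := LiftConn.cS_related O O' g hg' hmaps ΓM hM' ΓN hN' hcompat U hU γbar Y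
    (fun t ht => ht) (fun t _ => hγs.contDiffAt) (fun t _ => hYs.contDiffAt) i 0 h0U
  let W : Set (ℝ × ℝ) := C ⁻¹' O
  have hW : IsOpen W := hO.preimage hC.continuous
  have hF : ∀ p ∈ W, ContDiffAt ℝ ∞ (fun q => g (C q)) p := fun p hp =>
    (hg' _ hp).comp p hC.contDiffAt
  have h0W : ((0 : ℝ), (0 : ℝ)) ∈ W := h0U
  have hCs : ∀ t : ℝ, HasDerivAt (fun s => cbar t s) (Y t) 0 := by
    intro t
    have h1 : (fun s => cbar t s) = fun s => γbar t + s • Y t := by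
      funext s
      simp only [hγeq, cbar, Y, smul_add, Finset.sum_add_distrib, Finset.smul_sum]
      simp only [smul_comm s]
      abel
    rw [h1]
    simpa using ((hasDerivAt_id (0 : ℝ)).smul_const (Y t)).const_add (γbar t)
  have hFs : ∀ t ∈ U, fderiv ℝ (fun q => g (C q)) (t, 0) (0, 1) = fderiv ℝ g (γbar t) (Y t) := by
    intro t ht
    have hs : HasDerivAt (fun s : ℝ => (t, s)) ((0 : ℝ), (1 : ℝ)) 0 :=
      (hasDerivAt_const _ _).prodMk (hasDerivAt_id _)
    have a1 := ((hF (t, 0) ht).differentiableAt (by simp)).hasFDerivAt.comp_hasDerivAt 0 hs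
    have a2 := ((hg' (γbar t) ht).differentiableAt (by simp)).hasFDerivAt.comp_hasDerivAt
      (0 : ℝ) (hCs t)
    exact a1.unique a2
  have hηbar : ∀ j, LiftConn.tc (fun r => fderiv ℝ g (γbar r) (Y r)) j 0 = ηbar j := by
    intro j
    have h1 := LiftConn.swap_iter W hW j (fun q => g (C q)) hF (0, 0) h0W
    simp only [LiftConn.tc, ηbar]
    congr 1
    refine Eq.trans ?_ h1.symm
    apply Filter.EventuallyEq.iteratedDeriv_eq
    filter_upwards [hU.mem_nhds h0U] with t ht
    exact (hFs t ht).symm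
  have hybar : fderiv ℝ g (γbar 0) (Y 0) = ybar := by
    have a1 : HasFDerivAt g (fderiv ℝ g (γbar 0)) ((fun s => cbar 0 s) 0) :=
      ((hg' (γbar 0) h0U).differentiableAt (by simp)).hasFDerivAt
    have a2 := a1.comp_hasDerivAt (0 : ℝ) (hCs 0)
    exact a2.deriv.symm
  have hubar : (fun l => LiftConn.tc (fun r => g (γbar r)) l 0) = ubar := rfl
  have hind : ∀ j ≤ i, inducedM ΓM j (γbar 0) (fun l => LiftConn.tc γbar l 0)
      = inducedM ΓM j x ξ := by
    intro j hj
    rw [hγ0]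
    apply LiftConn.inducedM_congr
    intro l hl1 hl2
    rw [hγeq, LiftConn.poly_tc' l k x ξ (by omega), if_neg (by omega)]
  have htY : ∀ j, 1 ≤ j → j ≤ k → LiftConn.tc Y j 0 = η j := by
    intro j h1 h2
    have := LiftConn.poly_tc' j k y η h2
    rw [if_neg (by omega)] at this
    exact this
  rw [LiftConn.cS_expand _ _ _ _ hi1, LiftConn.cS_expand _ _ _ _ hi1] at main
  simp only [hηbar, hybar] at main
  rw [hubar] at main
  rw [← main, hind i le_rfl, hY0, htY i hi1 hik, hγ0]
  congr 3
  apply Finset.sum_congr rfl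
  intro j hj
  rw [Finset.mem_Icc] at hj
  rw [← hind j (by omega), htY (i-j) (by omega) (by omega), hγ0]
end

section
/- Assume the order-1 compatibility condition holds: for all x ∈ O and ξ, y ∈ E, Dg(x)(Γ_M(x)(ξ,y)) = D²g(x)(ξ,y) + Γ_N(g(x))(Dg(x)ξ, Dg(x)y). Fix (x, ξ_1, …, ξ_k) ∈ O × E^k and let μ̄ be the associated canonical curve, v_j = ( μ̄(0), μ̄^(1)(0), …, (1/j!)μ̄^(j)(0) ) and v̄_j = ( (g∘μ̄)(0), (g∘μ̄)^(1)(0), …, (1/j!)(g∘μ̄)^(j)(0) ). Then for every 2 ≤ i ≤ k: N^1(v̄_1)·(g∘μ̄)^(i−1)(0)/(i−2)! + ⋯ + N^{i−1}(v̄_{i−1})·(g∘μ̄)^(1)(0) = Dg(x)( μ̄^(i)(0)/(i−1)! ) + Dg(x)( M^1(v_1)·μ̄^(i−1)(0)/(i−2)! ) + ⋯ + Dg(x)( M^{i−1}(v_{i−1})·μ̄^(1)(0) ) − (g∘μ̄)^(i)(0)/(i−1)!. -/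
/-- The canonical curve `μ̄_k` associated to `(x, ξ₁, …, ξ_k)` and a Christoffel symbol
`Γ`: `μ̄₁ t = x + t•ξ₁`, and for `i ≥ 2`,
`μ̄_i t = μ̄_{i-1} t + (t^i/i) • ( i•ξ_i − ∑_{j=1}^{i-1} M^j(x, ξ₁, μ̄_{i-1}⁽²⁾(0)/2!, …, μ̄_{i-1}⁽ʲ⁾(0)/j!) (μ̄_{i-1}^{(i-j)}(0)/(i-j-1)!) )`. -/
noncomputable def canonCurve {E : Type*} [NormedAddCommGroup E] [NormedSpace ℝ E]
    (Γ : E → (E →L[ℝ] E →L[ℝ] E)) (x : E) (ξ : ℕ → E) : ℕ → ℝ → E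
  | 0 => fun _ => x
  | 1 => fun t => x + t • ξ 1
  | (n + 2) => fun t =>
      canonCurve Γ x ξ (n + 1) t
        + (t ^ (n + 2) / ((n + 2 : ℕ) : ℝ)) •
            ((((n + 2 : ℕ) : ℝ)) • ξ (n + 2)
              - ∑ j ∈ Finset.Icc 1 (n + 1),
                  (inducedM Γ j x
                      (fun m => ((Nat.factorial m : ℝ))⁻¹ •
                        iteratedDeriv m (canonCurve Γ x ξ (n + 1)) 0))
                    (((Nat.factorial (n + 1 - j) : ℝ))⁻¹ •
                      iteratedDeriv (n + 2 - j) (canonCurve Γ x ξ (n + 1)) 0))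

universe u w

theorem inducedM_congr {E : Type*} [NormedAddCommGroup E] [NormedSpace ℝ E]
    (Γ : E → (E →L[ℝ] E →L[ℝ] E)) (n : ℕ) : ∀ (x : E) (ξ η : ℕ → E),
    (∀ m, 1 ≤ m → m ≤ n → ξ m = η m) → inducedM Γ n x ξ = inducedM Γ n x η := by
  induction n with
  | zero => intro x ξ η h; simp [inducedM]
  | succ n ih =>
    intro x ξ η h
    rcases n with _ | n
    · simp [inducedM, h 1 le_rfl le_rfl]
    · have h1 : ∀ x', inducedM Γ (n + 1) x' ξ = inducedM Γ (n + 1) x' η := fun x' =>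
        ih x' ξ η (fun m hm hm' => h m hm (by omega))
      have h2 : ∀ j v, inducedM Γ (n + 1) x (Function.update ξ j v)
          = inducedM Γ (n + 1) x (Function.update η j v) := fun j v =>
        ih x _ _ (fun m hm hm' => by
          by_cases e : m = j
          · subst e; simp
          · simp [e, h m hm (by omega)])
      simp only [inducedM]
      simp only [h1, h2, h 1 le_rfl (by omega)]
      congr 3
      refine Finset.sum_congr rfl fun j hj => ?_
      rw [Finset.mem_Icc] at hj
      rw [h (j - 1) (by omega) (by omega), h j (by omega) (by omega)]

theorem inducedM_contDiffAt {E : Type u} [NormedAddCommGroup E] [NormedSpace ℝ E]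
    (Γ : E → (E →L[ℝ] E →L[ℝ] E)) (O : Set E) (hO : IsOpen O)
    (hΓ : ContDiffOn ℝ (⊤ : ℕ∞) Γ O) (n : ℕ) :
    ∀ (S : Type u) [NormedAddCommGroup S] [NormedSpace ℝ S] (a : S → E) (b : ℕ → S → E) (s : S),
    a s ∈ O → ContDiffAt ℝ (⊤ : ℕ∞) a s → (∀ m, ContDiffAt ℝ (⊤ : ℕ∞) (b m) s) →
    ContDiffAt ℝ (⊤ : ℕ∞) (fun s => inducedM Γ n (a s) (fun m => b m s)) s := by
  induction n with
  | zero => intros; simp only [inducedM]; exact contDiffAt_const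
  | succ n ih =>
    intro S _ _ a b s hs ha hb
    have hG : ContDiffAt ℝ (⊤ : ℕ∞) (fun s => Γ (a s) (b 1 s)) s :=
      ((hΓ.contDiffAt (hO.mem_nhds hs)).comp s ha).clm_apply (hb 1)
    rcases n with _ | n
    · simpa only [inducedM] using hG
    · simp only [inducedM]
      refine ContDiffAt.const_smul _ ((ContDiffAt.add ?_ ?_).add ?_)
      · refine ContDiffAt.clm_apply ?_ (contDiffAt_const.smul (hb 1))
        refine ContDiffAt.fderiv (n := (⊤ : ℕ∞)) (f := fun s x' => inducedM Γ (n + 1) x' fun m => b m s) ?_ ha (by simp)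
        exact ih (S × E) (fun p => p.2) (fun m p => b m p.1) (s, a s) hs contDiffAt_snd
          (fun m => (hb m).comp (s, a s) contDiffAt_fst)
      · refine ContDiffAt.sum fun j hj => ?_
        refine ContDiffAt.clm_apply ?_ (contDiffAt_const.smul (hb j))
        refine ContDiffAt.fderiv (n := (⊤ : ℕ∞)) (f := fun s v => inducedM Γ (n + 1) (a s)
          (Function.update (fun m => b m s) (j - 1) v)) ?_ (hb _) (by simp)
        refine ih (S × E) (fun p => a p.1)
          (fun m p => Function.update (fun m => b m p.1) (j - 1) p.2 m) (s, b (j - 1) s) hs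
          (ha.comp (s, _) contDiffAt_fst) (fun m => ?_)
        by_cases e : m = j - 1
        · subst e; simpa using contDiffAt_snd
        · simp only [Function.update_of_ne e]; exact (hb m).comp (s, b (j - 1) s) contDiffAt_fst
      · exact hG.clm_comp (ih S a b s hs ha hb)

abbrev IdxI (n : ℕ) : Type := {m : ℕ // m ∈ Finset.Icc 1 (n + 1)}

theorem inducedM_hasDerivAt {E : Type u} [NormedAddCommGroup E] [NormedSpace ℝ E]
    (Γ : E → (E →L[ℝ] E →L[ℝ] E)) (O : Set E) (hO : IsOpen O)
    (hΓ : ContDiffOn ℝ (⊤ : ℕ∞) Γ O) (n : ℕ) (c : ℝ → E) (w : ℕ → ℝ → E) (t : ℝ)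
    (ht : c t ∈ O) (hc : HasDerivAt c (w 1 t) t)
    (hw : ∀ m, HasDerivAt (w m) (((m + 1 : ℕ) : ℝ) • w (m + 1) t) t) :
    HasDerivAt (fun t => inducedM Γ (n + 1) (c t) (fun m => w m t))
      (((n + 2 : ℕ) : ℝ) • inducedM Γ (n + 2) (c t) (fun m => w m t)
        - (Γ (c t) (w 1 t)).comp (inducedM Γ (n + 1) (c t) (fun m => w m t))) t := by
  classical
  let ext : (IdxI n → E) → ℕ → E := fun q m => if h : m ∈ Finset.Icc 1 (n + 1) then q ⟨m, h⟩ else 0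
  let F : E × (IdxI n → E) → (E →L[ℝ] E) := fun p => inducedM Γ (n + 1) p.1 (fun m => ext p.2 m)
  have hext : ∀ (q : IdxI n → E) (m) (h : m ∈ Finset.Icc 1 (n + 1)), ext q m = q ⟨m, h⟩ :=
    fun q m h => by simp only [ext, dif_pos h]
  let Q : ℝ → (IdxI n → E) := fun t i => w i.1 t
  let Q' : IdxI n → E := fun i => ((i.1 + 1 : ℕ) : ℝ) • w (i.1 + 1) t
  have hF : DifferentiableAt ℝ F (c t, Q t) := by
    refine (inducedM_contDiffAt Γ O hO hΓ (n + 1) (E × (IdxI n → E)) (fun p => p.1)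
      (fun m p => ext p.2 m) (c t, Q t) ht contDiffAt_fst (fun m => ?_)).differentiableAt (by simp)
    by_cases h : m ∈ Finset.Icc 1 (n + 1)
    · simp only [hext _ m h]
      exact (contDiff_apply ℝ E (⟨m, h⟩ : IdxI n)).contDiffAt.comp (c t, Q t) contDiffAt_snd
    · simp only [ext, dif_neg h]; exact contDiffAt_const
  have hFeq : ∀ x ξ, F (x, fun i => ξ i.1) = inducedM Γ (n + 1) x ξ := by
    intro x ξ
    refine inducedM_congr Γ (n + 1) x _ _ fun m h1 h2 => ?_
    exact hext _ m (Finset.mem_Icc.2 ⟨h1, h2⟩)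
  have hQ : HasDerivAt Q Q' t := hasDerivAt_pi.2 fun i => hw i.1
  have hmain := hF.hasFDerivAt.comp_hasDerivAt t (hc.prodMk hQ)
  have e1 : (F ∘ fun t => (c t, Q t)) = fun t => inducedM Γ (n + 1) (c t) (fun m => w m t) := by
    funext s; exact hFeq (c s) (fun m => w m s)
  rw [e1] at hmain
  refine hmain.congr_deriv (Eq.symm ?_)
  have hx : fderiv ℝ (fun x' => inducedM Γ (n + 1) x' (fun m => w m t)) (c t) (w 1 t)
      = fderiv ℝ F (c t, Q t) (w 1 t, 0) := by
    have := (hF.hasFDerivAt.comp (c t)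
      (hasFDerivAt_prodMk_left (𝕜 := ℝ) (c t) (Q t))).fderiv
    have e : (F ∘ fun x' => (x', Q t)) = fun x' => inducedM Γ (n + 1) x' (fun m => w m t) := by
      funext x'; exact hFeq x' (fun m => w m t)
    rw [e] at this
    rw [this]; simp
  have hv : ∀ (i : IdxI n) (z : E), fderiv ℝ (fun v => inducedM Γ (n + 1) (c t)
        (Function.update (fun m => w m t) i.1 v)) (w i.1 t) z
      = fderiv ℝ F (c t, Q t) (0, Pi.single i z) := by
    intro i z
    have hu : HasFDerivAt (fun v => (c t, Function.update (Q t) i v))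
        ((0 : E →L[ℝ] E).prod (ContinuousLinearMap.single ℝ (fun _ : IdxI n => E) i)) (w i.1 t) := by
      refine (hasFDerivAt_const _ _).prodMk ?_
      refine (hasFDerivAt_update (𝕜 := ℝ) (E := fun _ : IdxI n => E) (i := i) (Q t)
        (w i.1 t)).congr_fderiv ?_
      ext z k
      by_cases hk : k = i
      · subst hk; simp
      · simp [hk]
    have hq : Function.update (Q t) i (w i.1 t) = Q t := Function.update_eq_self i (Q t)
    have hF' : HasFDerivAt F (fderiv ℝ F (c t, Q t)) (c t, Function.update (Q t) i (w i.1 t)) := by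
      rw [hq]; exact hF.hasFDerivAt
    have := (hF'.comp (w i.1 t) hu).fderiv
    have e : (F ∘ fun v => (c t, Function.update (Q t) i v)) = fun v => inducedM Γ (n + 1) (c t)
        (Function.update (fun m => w m t) i.1 v) := by
      funext v
      rw [← hFeq]
      simp only [Function.comp]
      congr 2
      funext k
      by_cases hk : k = i
      · subst hk; simp
      · have : k.1 ≠ i.1 := fun h => hk (Subtype.ext h)
        simp [hk, this, Q]
    rw [e] at this
    rw [this]; simp
  have hsplit : ((w 1 t, Q') : E × (IdxI n → E)) = (w 1 t, 0) + ∑ i : IdxI n, (0, Pi.single i (Q' i)) := by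
    ext1
    · simp [Prod.fst_sum]
    · rw [Prod.snd_add, Prod.snd_sum]; simp only [zero_add]; exact (Finset.univ_sum_single Q').symm
  have hsum : ∑ j ∈ Finset.Icc 2 (n + 2), (fderiv ℝ (fun v => inducedM Γ (n + 1) (c t)
        (Function.update (fun m => w m t) (j - 1) v)) (w (j - 1) t)) ((j : ℝ) • w j t)
      = ∑ i : IdxI n, fderiv ℝ F (c t, Q t) (0, Pi.single i (Q' i)) := by
    simp only [← hv]
    rw [Finset.sum_coe_sort (Finset.Icc 1 (n + 1)) (fun i => fderiv ℝ (fun v => inducedM Γ (n + 1) (c t)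
        (Function.update (fun m => w m t) i v)) (w i t) (((i + 1 : ℕ) : ℝ) • w (i + 1) t))]
    refine Finset.sum_nbij' (fun j => j - 1) (fun j => j + 1) ?_ ?_ ?_ ?_ ?_
    · intro j; simp only [Finset.mem_Icc]; omega
    · intro j; simp only [Finset.mem_Icc]; omega
    · intro j; simp only [Finset.mem_Icc]; omega
    · intro j; simp only [Finset.mem_Icc]; omega
    · intro j hj
      simp only [Finset.mem_Icc] at hj
      have : j - 1 + 1 = j := by omega
      simp only [this]
  rw [hsplit, map_add, map_sum, ← hx, ← hsum]
  have hne : ((n + 2 : ℕ) : ℝ) ≠ 0 := by positivity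
  conv_lhs => rw [inducedM]
  rw [smul_inv_smul₀ hne, one_smul, add_sub_cancel_right]

/-- Normalised iterated covariant derivative of the velocity. -/
noncomputable def covB {E : Type*} [NormedAddCommGroup E] [NormedSpace ℝ E]
    (Γ : E → (E →L[ℝ] E →L[ℝ] E)) (c : ℝ → E) (j : ℕ) (t : ℝ) : E →L[ℝ] E :=
  if j = 0 then ContinuousLinearMap.id ℝ E else
    inducedM Γ j (c t) (fun m => ((Nat.factorial m : ℝ))⁻¹ • iteratedDeriv m c t)

noncomputable def covS {E : Type*} [NormedAddCommGroup E] [NormedSpace ℝ E]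
    (Γ : E → (E →L[ℝ] E →L[ℝ] E)) (c : ℝ → E) (i : ℕ) (t : ℝ) : E :=
  ∑ j ∈ Finset.range (i + 1),
    covB Γ c j t (((Nat.factorial (i - j) : ℝ))⁻¹ • iteratedDeriv (i - j + 1) c t)

theorem iterDeriv_hasDerivAt {E : Type*} [NormedAddCommGroup E] [NormedSpace ℝ E]
    (c : ℝ → E) (t : ℝ) (hc : ContDiffAt ℝ (⊤ : ℕ∞) c t) (m : ℕ) :
    HasDerivAt (iteratedDeriv m c) (iteratedDeriv (m + 1) c t) t := by
  rw [iteratedDeriv_succ]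
  have : DifferentiableAt ℝ (iteratedDeriv m c) t := by
    rw [iteratedDeriv_eq_equiv_comp]
    refine (LinearIsometryEquiv.differentiableAt _).comp t ?_
    exact hc.differentiableAt_iteratedFDeriv (by exact_mod_cast WithTop.coe_lt_top m)
  exact this.hasDerivAt

theorem covS_hasDerivAt {E : Type u} [NormedAddCommGroup E] [NormedSpace ℝ E]
    (Γ : E → (E →L[ℝ] E →L[ℝ] E)) (O : Set E) (hO : IsOpen O)
    (hΓ : ContDiffOn ℝ (⊤ : ℕ∞) Γ O) (c : ℝ → E) (t : ℝ)
    (ht : c t ∈ O) (hc : ContDiffAt ℝ (⊤ : ℕ∞) c t) (i : ℕ) :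
    HasDerivAt (covS Γ c i)
      (((i + 1 : ℕ) : ℝ) • covS Γ c (i + 1) t - Γ (c t) (deriv c t) (covS Γ c i t)) t := by
  have hd := iterDeriv_hasDerivAt c t hc
  have hw : ∀ m : ℕ, HasDerivAt (fun t => ((Nat.factorial m : ℝ))⁻¹ • iteratedDeriv m c t)
      (((m + 1 : ℕ) : ℝ) • ((Nat.factorial (m + 1) : ℝ))⁻¹ • iteratedDeriv (m + 1) c t) t := by
    intro m
    refine ((hd m).const_smul ((Nat.factorial m : ℝ))⁻¹).congr_deriv ?_
    rw [smul_smul, Nat.factorial_succ]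
    congr 1
    push_cast
    field_simp
  have hw' : ∀ m : ℕ, HasDerivAt (fun t => ((Nat.factorial m : ℝ))⁻¹ • iteratedDeriv (m + 1) c t)
      (((m + 1 : ℕ) : ℝ) • ((Nat.factorial (m + 1) : ℝ))⁻¹ • iteratedDeriv (m + 1 + 1) c t) t := by
    intro m
    refine ((hd (m + 1)).const_smul ((Nat.factorial m : ℝ))⁻¹).congr_deriv ?_
    rw [smul_smul, Nat.factorial_succ]
    congr 1
    push_cast
    field_simp
  have hB : ∀ j, HasDerivAt (covB Γ c j) (((j + 1 : ℕ) : ℝ) • covB Γ c (j + 1) t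
      - (Γ (c t) (deriv c t)).comp (covB Γ c j t)) t := by
    intro j
    rcases j with _ | n
    · have : covB Γ c 0 = fun _ => ContinuousLinearMap.id ℝ E := by funext s; simp [covB]
      rw [this]
      refine (hasDerivAt_const t (ContinuousLinearMap.id ℝ E)).congr_deriv ?_
      ext y
      simp [covB, inducedM, iteratedDeriv_one]
    · have := inducedM_hasDerivAt Γ O hO hΓ n c
        (fun m t => ((Nat.factorial m : ℝ))⁻¹ • iteratedDeriv m c t) t ht
        (by simpa [iteratedDeriv_one] using hd 0) hw
      have e1 : covB Γ c (n + 1) = fun t => inducedM Γ (n + 1) (c t)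
          (fun m => ((Nat.factorial m : ℝ))⁻¹ • iteratedDeriv m c t) := by
        funext s; simp [covB]
      have e2 : covB Γ c (n + 1 + 1) t = inducedM Γ (n + 2) (c t)
          (fun m => ((Nat.factorial m : ℝ))⁻¹ • iteratedDeriv m c t) := by simp [covB]
      have e3 : ((Nat.factorial 1 : ℝ))⁻¹ • iteratedDeriv 1 c t = deriv c t := by
        simp [iteratedDeriv_one]
      simp only [e3] at this
      rw [e2, e1]
      exact this
  have hS := HasDerivAt.fun_sum (u := Finset.range (i + 1))
    (fun j _ => (hB j).clm_apply (hw' (i - j)))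
  have e : covS Γ c i = fun t => ∑ j ∈ Finset.range (i + 1),
    covB Γ c j t (((Nat.factorial (i - j) : ℝ))⁻¹ • iteratedDeriv (i - j + 1) c t) := rfl
  rw [e]
  refine hS.congr_deriv (Eq.symm ?_)
  set W : ℕ → E := fun m => ((Nat.factorial m : ℝ))⁻¹ • iteratedDeriv (m + 1) c t with hW
  set B : ℕ → E →L[ℝ] E := fun j => covB Γ c j t with hBdef
  set A := Γ (c t) (deriv c t) with hA
  have goal : ((i + 1 : ℕ) : ℝ) • ∑ j ∈ Finset.range (i + 1 + 1), B j (W (i + 1 - j))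
      - A (∑ j ∈ Finset.range (i + 1), B j (W (i - j)))
      = ∑ j ∈ Finset.range (i + 1), ((((j + 1 : ℕ) : ℝ) • B (j + 1) - A.comp (B j)) (W (i - j))
        + B j (((i - j + 1 : ℕ) : ℝ) • W (i - j + 1))) := by
    have p1 : ∑ j ∈ Finset.range (i + 1), ((j + 1 : ℕ) : ℝ) • B (j + 1) (W (i - j))
        = ∑ j ∈ Finset.range (i + 1 + 1), (j : ℝ) • B j (W (i + 1 - j)) := by
      rw [Finset.sum_range_succ' _ (i + 1)]
      simp
    have p2 : ∑ j ∈ Finset.range (i + 1), ((i - j + 1 : ℕ) : ℝ) • B j (W (i - j + 1))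
        = ∑ j ∈ Finset.range (i + 1 + 1), ((i + 1 - j : ℕ) : ℝ) • B j (W (i + 1 - j)) := by
      rw [Finset.sum_range_succ _ (i + 1)]
      simp only [Nat.sub_self, Nat.cast_zero, zero_smul, add_zero]
      refine Finset.sum_congr rfl fun j hj => ?_
      rw [Finset.mem_range] at hj
      rw [show i + 1 - j = i - j + 1 by omega]
    simp only [sub_apply, smul_apply,
      ContinuousLinearMap.comp_apply, map_smul, Finset.sum_add_distrib, Finset.sum_sub_distrib]
    rw [p1, p2, map_sum, sub_add_eq_add_sub, ← Finset.sum_add_distrib, Finset.smul_sum]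
    congr 1
    refine Finset.sum_congr rfl fun j hj => ?_
    rw [Finset.mem_range] at hj
    rw [← add_smul, ← Nat.cast_add]
    congr 2
    omega
  exact goal

theorem covS_map {E : Type u} {E' : Type w} [NormedAddCommGroup E] [NormedSpace ℝ E]
    [NormedAddCommGroup E'] [NormedSpace ℝ E']
    (O : Set E) (O' : Set E') (hO : IsOpen O) (hO' : IsOpen O')
    (g : E → E') (hg : ContDiffOn ℝ (⊤ : ℕ∞) g O) (hmaps : Set.MapsTo g O O')
    (ΓM : E → (E →L[ℝ] E →L[ℝ] E)) (hΓM : ContDiffOn ℝ (⊤ : ℕ∞) ΓM O)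
    (ΓN : E' → (E' →L[ℝ] E' →L[ℝ] E')) (hΓN : ContDiffOn ℝ (⊤ : ℕ∞) ΓN O')
    (hcompat : ∀ x ∈ O, ∀ ξ y : E,
      fderiv ℝ g x (ΓM x ξ y)
        = fderiv ℝ (fderiv ℝ g) x ξ y
          + ΓN (g x) (fderiv ℝ g x ξ) (fderiv ℝ g x y))
    (μ : ℝ → E) (hμ : ContDiff ℝ (⊤ : ℕ∞) μ) (i : ℕ) :
    ∀ t, μ t ∈ O → fderiv ℝ g (μ t) (covS ΓM μ i t) = covS ΓN (fun t => g (μ t)) i t := by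
  have hgd : ∀ t, μ t ∈ O → HasDerivAt (fun t => g (μ t)) (fderiv ℝ g (μ t) (deriv μ t)) t := by
    intro t ht
    exact ((hg.contDiffAt (hO.mem_nhds ht)).differentiableAt (by simp)).hasFDerivAt.comp_hasDerivAt t
      ((hμ.differentiable (by simp)) t).hasDerivAt
  induction i with
  | zero =>
    intro t ht
    simp [covS, covB, iteratedDeriv_one, (hgd t ht).deriv]
  | succ i ih =>
    intro t ht
    have hgt := hg.contDiffAt (hO.mem_nhds ht)
    have hdg : DifferentiableAt ℝ (fderiv ℝ g) (μ t) :=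
      (hgt.fderiv_right (m := (⊤ : ℕ∞)) (by simp)).differentiableAt (by simp)
    have h1 := (hdg.hasFDerivAt.comp_hasDerivAt t
      ((hμ.differentiable (by simp)) t).hasDerivAt).clm_apply
      (covS_hasDerivAt ΓM O hO hΓM μ t ht hμ.contDiffAt i)
    have h2 := covS_hasDerivAt ΓN O' hO' hΓN (fun t => g (μ t)) t (hmaps ht)
      (hgt.comp t hμ.contDiffAt) i
    have hev : covS ΓN (fun t => g (μ t)) i =ᶠ[nhds t]
        fun t => fderiv ℝ g (μ t) (covS ΓM μ i t) := by
      filter_upwards [hμ.continuous.continuousAt.preimage_mem_nhds (hO.mem_nhds ht)] with s hs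
      exact (ih s hs).symm
    have h3 := h1.unique (h2.congr_of_eventuallyEq hev.symm)
    simp only [Function.comp_apply] at h3
    rw [map_sub, map_smul, hcompat _ ht, ih t ht, (hgd t ht).deriv] at h3
    have hne : ((i + 1 : ℕ) : ℝ) ≠ 0 := by positivity
    refine smul_right_injective E' hne ?_
    simp only
    have h4 := congrArg (· + ΓN (g (μ t)) (fderiv ℝ g (μ t) (deriv μ t))
      (covS ΓN (fun t => g (μ t)) i t)) h3
    simp only [sub_add_cancel] at h4
    rw [← h4]
    abel

theorem canonCurve_contDiff {E : Type*} [NormedAddCommGroup E] [NormedSpace ℝ E]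
    (Γ : E → (E →L[ℝ] E →L[ℝ] E)) (x : E) (ξ : ℕ → E) (k : ℕ) :
    ContDiff ℝ (⊤ : ℕ∞) (canonCurve Γ x ξ k) ∧ canonCurve Γ x ξ k 0 = x := by
  induction k with
  | zero => simp only [canonCurve]; exact ⟨contDiff_const, trivial⟩
  | succ k ih =>
    rcases k with _ | n
    · simp only [canonCurve]
      exact ⟨contDiff_const.add (contDiff_id.smul contDiff_const), by simp⟩
    · simp only [canonCurve]
      refine ⟨ih.1.add (((contDiff_id.pow _).div_const _).smul contDiff_const), ?_⟩
      rw [ih.2]; simp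

theorem covS_expand {E : Type*} [NormedAddCommGroup E] [NormedSpace ℝ E]
    (Γ : E → (E →L[ℝ] E →L[ℝ] E)) (c : ℝ → E) (i : ℕ) (hi : 2 ≤ i) (t : ℝ) :
    covS Γ c (i - 1) t = (∑ j ∈ Finset.Icc 1 (i - 1),
      inducedM Γ j (c t) (fun m => ((Nat.factorial m : ℝ))⁻¹ • iteratedDeriv m c t)
        (((Nat.factorial (i - j - 1) : ℝ))⁻¹ • iteratedDeriv (i - j) c t))
      + ((Nat.factorial (i - 1) : ℝ))⁻¹ • iteratedDeriv i c t := by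
  obtain ⟨n, rfl⟩ : ∃ n, i = n + 1 := ⟨i - 1, by omega⟩
  simp only [Nat.add_sub_cancel, covS]
  rw [Finset.sum_range_succ' _ n]
  refine congrArg₂ (· + ·) ?_ ?_
  · rw [Finset.range_eq_Ico, Finset.sum_Ico_add' (fun j => covB Γ c j t
      (((Nat.factorial (n - j) : ℝ))⁻¹ • iteratedDeriv (n - j + 1) c t)) 0 n 1]
    refine Finset.sum_congr ?_ fun j hj => ?_
    · ext j; simp only [Finset.mem_Ico, Finset.mem_Icc]; omega
    · simp only [Finset.mem_Icc] at hj
      rw [show n + 1 - j - 1 = n - j by omega, show n + 1 - j = n - j + 1 by omega]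
      simp only [covB, if_neg (show j ≠ 0 by omega)]
  · simp [covB]

/-- **Step 1 identity in the proof that `T^k g` is a vector bundle morphism.**
Assume the order-1 compatibility condition for `Γ_M`, `Γ_N` along `g`. For the canonical
curve `μ̄` associated to `(x, ξ₁, …, ξ_k)`, with `v_j = (μ̄(0), μ̄^(1)(0), …, μ̄^(j)(0)/j!)`
and `v̄_j = ((g∘μ̄)(0), (g∘μ̄)^(1)(0), …, (g∘μ̄)^(j)(0)/j!)`, for every `2 ≤ i ≤ k`:
`N^1(v̄₁)(g∘μ̄)^(i−1)(0)/(i−2)! + ⋯ + N^{i−1}(v̄_{i−1})(g∘μ̄)^(1)(0)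
  = Dg(x)(μ̄^(i)(0)/(i−1)!) + Dg(x)(M^1(v₁) μ̄^(i−1)(0)/(i−2)!) + ⋯ + Dg(x)(M^{i−1}(v_{i−1}) μ̄^(1)(0)) − (g∘μ̄)^(i)(0)/(i−1)!`. -/
theorem step_one_identity
    {E E' : Type*} [NormedAddCommGroup E] [NormedSpace ℝ E]
    [NormedAddCommGroup E'] [NormedSpace ℝ E']
    (O : Set E) (O' : Set E') (hO : IsOpen O) (hO' : IsOpen O')
    (g : E → E') (hg : ContDiffOn ℝ (⊤ : ℕ∞) g O) (hmaps : Set.MapsTo g O O')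
    (ΓM : E → (E →L[ℝ] E →L[ℝ] E)) (hΓM : ContDiffOn ℝ (⊤ : ℕ∞) ΓM O)
    (ΓN : E' → (E' →L[ℝ] E' →L[ℝ] E')) (hΓN : ContDiffOn ℝ (⊤ : ℕ∞) ΓN O')
    (hcompat : ∀ x ∈ O, ∀ ξ y : E,
      fderiv ℝ g x (ΓM x ξ y)
        = fderiv ℝ (fderiv ℝ g) x ξ y
          + ΓN (g x) (fderiv ℝ g x ξ) (fderiv ℝ g x y))
    (k : ℕ) (hk : 2 ≤ k) (x : E) (hx : x ∈ O) (ξ : ℕ → E) :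
    let μ : ℝ → E := canonCurve ΓM x ξ k
    let v : ℕ → E := fun m => ((Nat.factorial m : ℝ))⁻¹ • iteratedDeriv m μ 0
    let vbar : ℕ → E' := fun m =>
      ((Nat.factorial m : ℝ))⁻¹ • iteratedDeriv m (fun t => g (μ t)) 0
    ∀ i : ℕ, 2 ≤ i → i ≤ k →
      (∑ j ∈ Finset.Icc 1 (i - 1),
          inducedM ΓN j (g (μ 0)) vbar
            (((Nat.factorial (i - j - 1) : ℝ))⁻¹ • iteratedDeriv (i - j) (fun t => g (μ t)) 0))
        = fderiv ℝ g x (((Nat.factorial (i - 1) : ℝ))⁻¹ • iteratedDeriv i μ 0)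
          + (∑ j ∈ Finset.Icc 1 (i - 1),
              fderiv ℝ g x
                (inducedM ΓM j (μ 0) v
                  (((Nat.factorial (i - j - 1) : ℝ))⁻¹ • iteratedDeriv (i - j) μ 0)))
          - ((Nat.factorial (i - 1) : ℝ))⁻¹ • iteratedDeriv i (fun t => g (μ t)) 0 := by
  intro μ v vbar i hi hik
  obtain ⟨hμ, hμ0⟩ := canonCurve_contDiff ΓM x ξ k
  have h := covS_map O O' hO hO' g hg hmaps ΓM hΓM ΓN hΓN hcompat μ hμ (i - 1) 0
    (by rw [show μ 0 = x from hμ0]; exact hx)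
  rw [covS_expand ΓM μ i hi, covS_expand ΓN _ i hi, map_add, map_sum,
    show μ 0 = x from hμ0] at h
  rw [show μ 0 = x from hμ0, eq_sub_iff_add_eq, add_comm (fderiv ℝ g x _)]
  exact h.symm
end
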